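/- There is no 2-colouring of K(C_10) containing no monochromatic planar K_4 that is invariant under the alternating group A_10 (the subgroup of even permutations of the 10 coordinates) acting on vertices by permuting coordinates. -/

import Mathlib

/-- The vertex `v : Fin n → Bool` of the hypercube, regarded as a point of `ℝ^n`. -/
def toPoint (n : ℕ) (v : Fin n → Bool) : Fin n → ℝ := fun i => if v i then 1 else 0

/-- The colouring `c` of the edges of `K(C_n)` contains no monochromatic planar `K₄`:
no four distinct coplanar vertices have all six connecting edges the same colour. -/
def NoMonoPlanarK4 (n : ℕ) (c : Sym2 (Fin n → Bool) → Bool) : Prop :=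
  ∀ a b d e : Fin n → Bool,
    a ≠ b → a ≠ d → a ≠ e → b ≠ d → b ≠ e → d ≠ e →
    Coplanar ℝ ({toPoint n a, toPoint n b, toPoint n d, toPoint n e} : Set (Fin n → ℝ)) →
    ¬ (c s(a, b) = c s(a, d) ∧ c s(a, b) = c s(a, e) ∧
       c s(a, b) = c s(b, d) ∧ c s(a, b) = c s(b, e) ∧ c s(a, b) = c s(d, e))

/-- The action of a coordinate permutation on a vertex of the hypercube:
`(σ • v) i = v (σ⁻¹ i)`. -/
def permAct (n : ℕ) (σ : Equiv.Perm (Fin n)) (v : Fin n → Bool) : Fin n → Bool :=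
  fun i => v (σ⁻¹ i)

/-- The colouring `c` is invariant under the subgroup `G` of coordinate permutations. -/
def InvariantUnder (n : ℕ) (G : Subgroup (Equiv.Perm (Fin n)))
    (c : Sym2 (Fin n → Bool) → Bool) : Prop :=
  ∀ σ ∈ G, ∀ u v : Fin n → Bool, u ≠ v →
    c s(permAct n σ u, permAct n σ v) = c s(u, v)

/-- Four vertices satisfying the parallelogram identity `a + b = d + e` are coplanar. -/
theorem coplanar_toPoint_of_add_eq {n : ℕ} {a b d e : Fin n → Bool}
    (h : ∀ i, (a i).toNat + (b i).toNat = (d i).toNat + (e i).toNat) :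
    Coplanar ℝ ({toPoint n a, toPoint n b, toPoint n d, toPoint n e} : Set (Fin n → ℝ)) := by
  have hadd : toPoint n a = (toPoint n d - toPoint n b) + toPoint n e := by
    ext i
    have hi := h i
    cases ha : a i <;> cases hb : b i <;> cases hd : d i <;> cases he : e i <;>
      simp [toPoint, ha, hb, hd, he] at hi ⊢
  have hmem : toPoint n a ∈ affineSpan ℝ {toPoint n b, toPoint n d, toPoint n e} := by
    rw [hadd, ← vsub_eq_sub, ← vadd_eq_add]
    exact AffineSubspace.vadd_mem_of_mem_direction
      (AffineSubspace.vsub_mem_direction (mem_affineSpan ℝ (by simp))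
        (mem_affineSpan ℝ (by simp))) (mem_affineSpan ℝ (by simp))
  rw [coplanar_insert_iff_of_mem_affineSpan hmem]
  exact coplanar_triple ℝ _ _ _

/-- Two pairs of vertices with the same number of coordinates of each kind are related by an
even permutation, as soon as there are more than four coordinates. -/
theorem exists_alternatingGroup_permAct_eq {n : ℕ} (hn : 4 < n) {u v u' v' : Fin n → Bool}
    (h : ∀ x y, Fintype.card {i // u i = x ∧ v i = y} = Fintype.card {i // u' i = x ∧ v' i = y}) :
    ∃ σ ∈ alternatingGroup (Fin n), permAct n σ u = u' ∧ permAct n σ v = v' := by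
  have hcard : ∀ p : Bool × Bool,
      Fintype.card {i // (u i, v i) = p} = Fintype.card {i // (u' i, v' i) = p} := by
    rintro ⟨x, y⟩
    simpa only [Prod.mk.injEq] using h x y
  let E := fun p => Fintype.equivOfCardEq (hcard p)
  let τ : Equiv.Perm (Fin n) := Equiv.ofFiberEquiv E
  have hτ : ∀ i, (u' (τ i), v' (τ i)) = (u i, v i) := Equiv.ofFiberEquiv_map E
  have of_map : ∀ σ : Equiv.Perm (Fin n), (∀ i, (u' (σ i), v' (σ i)) = (u i, v i)) →
      permAct n σ u = u' ∧ permAct n σ v = v' := by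
    intro σ hσ
    have hσ' := fun i => Prod.ext_iff.mp (hσ (σ⁻¹ i))
    simp only [show ∀ i, σ (σ⁻¹ i) = i from σ.apply_symm_apply] at hσ'
    exact ⟨funext fun i => (hσ' i).1.symm, funext fun i => (hσ' i).2.symm⟩
  rcases Int.units_eq_one_or (Equiv.Perm.sign τ) with hs | hs
  · exact ⟨τ, Equiv.Perm.mem_alternatingGroup.mpr hs, of_map τ hτ⟩
  · obtain ⟨i, j, hij, hf⟩ :=
      Fintype.exists_ne_map_eq_of_card_lt (fun i => (u i, v i)) (by simpa using hn)
    refine ⟨τ * Equiv.swap i j, ?_, of_map _ fun k => ?_⟩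
    · rw [Equiv.Perm.mem_alternatingGroup, Equiv.Perm.sign_mul, hs, Equiv.Perm.sign_swap hij]
      rfl
    · rw [Equiv.Perm.mul_apply, hτ]
      exact Equiv.apply_swap_eq_self (v := fun i => (u i, v i)) hf k

/-- The vertex of `C_10` whose support is the interval of length five starting at `k`. -/
def window (k : ℕ) : Fin 10 → Bool := fun i => decide (k ≤ i ∧ i < k + 5)

/-- The vertices `u ≠ v` have as many coordinates of each kind as `window 0, window k`. -/
def SameKind (k : ℕ) (u v : Fin 10 → Bool) : Prop :=
  u ≠ v ∧ ∀ x y, Fintype.card {i // u i = x ∧ v i = y} =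
    Fintype.card {i // window 0 i = x ∧ window k i = y}

instance (k : ℕ) (u v : Fin 10 → Bool) : Decidable (SameKind k u v) :=
  inferInstanceAs (Decidable (_ ∧ _))

theorem InvariantUnder.eq_of_sameKind {c : Sym2 (Fin 10 → Bool) → Bool}
    (hc : InvariantUnder 10 (alternatingGroup (Fin 10)) c) {k : ℕ} {u v : Fin 10 → Bool}
    (h : SameKind k u v) : c s(u, v) = c s(window 0, window k) := by
  obtain ⟨σ, hσ, hu, hv⟩ := exists_alternatingGroup_permAct_eq (by norm_num) h.2
  rw [← hc σ hσ u v h.1, hu, hv]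

/-- The sides and diagonals of a parallelogram `a + b = d + e` which have only the kinds
`k₁`, `k₂`, `k₃` do not let these three kinds receive the same colour. -/
theorem NoMonoPlanarK4.not_mono_of_window {c : Sym2 (Fin 10 → Bool) → Bool}
    (hc : NoMonoPlanarK4 10 c) (hG : InvariantUnder 10 (alternatingGroup (Fin 10)) c)
    {a b d e : Fin 10 → Bool} {k₁ k₂ k₃ : ℕ}
    (h : (∀ i, (a i).toNat + (b i).toNat = (d i).toNat + (e i).toNat) ∧
      SameKind k₁ a b ∧ SameKind k₁ d e ∧ SameKind k₂ a d ∧ SameKind k₂ b e ∧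
      SameKind k₃ a e ∧ SameKind k₃ b d) :
    ¬ (c s(window 0, window k₁) = c s(window 0, window k₂) ∧
      c s(window 0, window k₁) = c s(window 0, window k₃)) := by
  obtain ⟨hadd, hab, hde, had, hbe, hae, hbd⟩ := h
  have := hc a b d e hab.1 had.1 hae.1 hbd.1 hbe.1 hde.1 (coplanar_toPoint_of_add_eq hadd)
  rw [hG.eq_of_sameKind hab, hG.eq_of_sameKind hde, hG.eq_of_sameKind had,
    hG.eq_of_sameKind hbe, hG.eq_of_sameKind hae, hG.eq_of_sameKind hbd] at this
  tauto

theorem no_A10_invariant_good_colouring :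
    ¬ ∃ c : Sym2 (Fin 10 → Bool) → Bool, NoMonoPlanarK4 10 c ∧
      InvariantUnder 10 (alternatingGroup (Fin 10)) c := by
  rintro ⟨c, hc, hG⟩
  have h₄₂ := hc.not_mono_of_window hG
    (a := ![true, true, true, true, true, false, false, false, false, false])
    (b := ![true, false, false, false, false, true, true, true, true, false])
    (d := ![true, true, true, false, false, true, true, false, false, false])
    (e := ![true, false, false, true, true, false, false, true, true, false])
    (k₁ := 4) (k₂ := 2) (k₃ := 2) (by decide)
  have h₂₁ := hc.not_mono_of_window hG
    (a := ![true, true, true, true, true, false, false, false, false, false])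
    (b := ![true, true, true, false, false, true, true, false, false, false])
    (d := ![true, true, true, true, false, true, false, false, false, false])
    (e := ![true, true, true, false, true, false, true, false, false, false])
    (k₁ := 2) (k₂ := 1) (k₃ := 1) (by decide)
  have h₅₄₁ := hc.not_mono_of_window hG
    (a := ![true, true, true, true, true, false, false, false, false, false])
    (b := ![false, false, false, false, false, true, true, true, true, true])
    (d := ![true, false, false, false, false, true, true, true, true, false])
    (e := ![false, true, true, true, true, false, false, false, false, true])
    (k₁ := 5) (k₂ := 4) (k₃ := 1) (by decide)
  have h₅₃₂ := hc.not_mono_of_window hG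
    (a := ![true, true, true, true, true, false, false, false, false, false])
    (b := ![false, false, false, false, false, true, true, true, true, true])
    (d := ![true, true, false, false, false, true, true, true, false, false])
    (e := ![false, false, true, true, true, false, false, false, true, true])
    (k₁ := 5) (k₂ := 3) (k₃ := 2) (by decide)
  have h₄₃₁ := hc.not_mono_of_window hG
    (a := ![true, true, true, true, true, false, false, false, false, false])
    (b := ![true, false, false, false, false, true, true, true, true, false])
    (d := ![true, true, false, false, false, true, true, true, false, false])
    (e := ![true, false, true, true, true, false, false, false, true, false])
    (k₁ := 4) (k₂ := 3) (k₃ := 1) (by decide)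
  generalize c s(window 0, window 1) = x₁ at *
  generalize c s(window 0, window 2) = x₂ at *
  generalize c s(window 0, window 3) = x₃ at *
  generalize c s(window 0, window 4) = x₄ at *
  generalize c s(window 0, window 5) = x₅ at *
  clear hc hG
  revert x₁ x₂ x₃ x₄ x₅
  decide
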